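/- Suppose the linear operators 𝒜₁,…,𝒜ₛ : ℝ^{n×n} → ℝ^m satisfy the ARIP at rank 3r with parameter δ₃ᵣ < 1. Let X₁,…,Xₛ ∈ ℝ^{n×n} have rank at most r, let y = Σ_{k=1}^s 𝒜_k(X_k), and for each k let X_{k,0} be a best rank-r approximation of 𝒜_k^*(y). Then √(Σ_{k=1}^s ‖X_{k,0} − X_k‖_F²) ≤ 2δ₃ᵣ · √(Σ_{k=1}^s ‖X_k‖_F²). -/

import Mathlib

open Matrix MeasureTheory ProbabilityTheory Finset

noncomputable section

/-- Frobenius inner product on square real matrices: `⟨X,Y⟩ = trace (Xᵀ Y)`. -/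
def finner {n : ℕ} (X Y : Matrix (Fin n) (Fin n) ℝ) : ℝ := (Xᵀ * Y).trace

/-- Frobenius norm. -/
def fnorm {n : ℕ} (X : Matrix (Fin n) (Fin n) ℝ) : ℝ := Real.sqrt (finner X X)

/-- Euclidean norm on `ℝ^m`. -/
def enorm2 {m : ℕ} (v : Fin m → ℝ) : ℝ := Real.sqrt (∑ p, (v p) ^ 2)

/-- The linear operator `𝒜` associated with measurement matrices `A_p`:
`(𝒜 Z)_p = (1/√m) ⟨A_p, Z⟩`. -/
def opA {n m : ℕ} (A : Fin m → Matrix (Fin n) (Fin n) ℝ)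
    (Z : Matrix (Fin n) (Fin n) ℝ) : Fin m → ℝ :=
  fun p => (1 / Real.sqrt m) * finner (A p) Z

/-- The adjoint operator `𝒜^* v = (1/√m) Σ_p v_p A_p`. -/
def adjA {n m : ℕ} (A : Fin m → Matrix (Fin n) (Fin n) ℝ)
    (v : Fin m → ℝ) : Matrix (Fin n) (Fin n) ℝ :=
  (1 / Real.sqrt m) • ∑ p, v p • A p

/-- Amalgam restricted isometry property at rank `r` with parameter `δ`. -/
def ARIP {n m s : ℕ} (𝒜 : Fin s → Matrix (Fin n) (Fin n) ℝ → (Fin m → ℝ))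
    (r : ℕ) (δ : ℝ) : Prop :=
  ∀ Z : Fin s → Matrix (Fin n) (Fin n) ℝ, (∀ k, (Z k).rank ≤ r) →
    (1 - δ) * ∑ k, fnorm (Z k) ^ 2 ≤ enorm2 (∑ k, 𝒜 k (Z k)) ^ 2 ∧
    enorm2 (∑ k, 𝒜 k (Z k)) ^ 2 ≤ (1 + δ) * ∑ k, fnorm (Z k) ^ 2

/-- Orthogonal projection onto the tangent space determined by the SVD factors `U`, `V`:
`P_T(G) = UUᵀG + GVVᵀ − UUᵀGVVᵀ`. -/
def Pt {n r : ℕ} (U V : Matrix (Fin n) (Fin r) ℝ)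
    (G : Matrix (Fin n) (Fin n) ℝ) : Matrix (Fin n) (Fin n) ℝ :=
  U * Uᵀ * G + G * (V * Vᵀ) - U * Uᵀ * G * (V * Vᵀ)

/-- `X'` is a best rank-`r` approximation of `W` in Frobenius norm. -/
def IsBestRankApprox {n : ℕ} (r : ℕ) (W X' : Matrix (Fin n) (Fin n) ℝ) : Prop :=
  X'.rank ≤ r ∧ ∀ Z : Matrix (Fin n) (Fin n) ℝ, Z.rank ≤ r → fnorm (X' - W) ≤ fnorm (Z - W)

theorem finner_self_nonneg' {n : ℕ} (X : Matrix (Fin n) (Fin n) ℝ) : 0 ≤ finner X X := by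
  unfold finner
  simp only [Matrix.trace, Matrix.diag, Matrix.mul_apply, Matrix.transpose_apply]
  exact Finset.sum_nonneg fun i _ => Finset.sum_nonneg fun j _ => mul_self_nonneg _

theorem fnorm_sq' {n : ℕ} (X : Matrix (Fin n) (Fin n) ℝ) : fnorm X ^ 2 = finner X X :=
  Real.sq_sqrt (finner_self_nonneg' X)

theorem enorm2_sq' {m : ℕ} (v : Fin m → ℝ) : enorm2 v ^ 2 = ∑ p, v p ^ 2 :=
  Real.sq_sqrt (Finset.sum_nonneg fun _ _ => sq_nonneg _)

theorem finner_comm' {n : ℕ} (X Y : Matrix (Fin n) (Fin n) ℝ) : finner X Y = finner Y X := by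
  unfold finner
  rw [← Matrix.trace_transpose, Matrix.transpose_mul, Matrix.transpose_transpose]

theorem finner_add_right' {n : ℕ} (X Y Z : Matrix (Fin n) (Fin n) ℝ) :
    finner X (Y + Z) = finner X Y + finner X Z := by
  simp [finner, Matrix.mul_add]

theorem finner_sub_right' {n : ℕ} (X Y Z : Matrix (Fin n) (Fin n) ℝ) :
    finner X (Y - Z) = finner X Y - finner X Z := by
  simp [finner, Matrix.mul_sub]

theorem finner_smul_right' {n : ℕ} (c : ℝ) (X Y : Matrix (Fin n) (Fin n) ℝ) :
    finner X (c • Y) = c * finner X Y := by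
  simp [finner]

theorem finner_sum_right' {n m : ℕ} (X : Matrix (Fin n) (Fin n) ℝ)
    (Y : Fin m → Matrix (Fin n) (Fin n) ℝ) :
    finner X (∑ p, Y p) = ∑ p, finner X (Y p) := by
  simp [finner, Matrix.mul_sum, Matrix.trace_sum]

theorem finner_expand' {n : ℕ} (t : ℝ) (X Y : Matrix (Fin n) (Fin n) ℝ) :
    finner (X + t • Y) (X + t • Y) = finner X X + 2 * t * finner X Y + t ^ 2 * finner Y Y := by
  rw [finner_add_right', finner_comm' _ X, finner_smul_right', finner_comm' _ Y,
    finner_add_right', finner_add_right', finner_smul_right', finner_smul_right',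
    finner_comm' Y X]
  ring

theorem finner_adjA' {n m : ℕ} (A : Fin m → Matrix (Fin n) (Fin n) ℝ) (v : Fin m → ℝ)
    (Z : Matrix (Fin n) (Fin n) ℝ) : finner Z (adjA A v) = ∑ p, opA A Z p * v p := by
  unfold adjA opA
  rw [finner_smul_right', finner_sum_right', Finset.mul_sum]
  refine Finset.sum_congr rfl fun p _ => ?_
  rw [finner_smul_right', finner_comm' Z]
  ring

theorem opA_expand' {n m : ℕ} (A : Fin m → Matrix (Fin n) (Fin n) ℝ) (t : ℝ)
    (X Y : Matrix (Fin n) (Fin n) ℝ) : opA A (X + t • Y) = opA A X + t • opA A Y := by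
  ext p
  simp only [opA, Pi.add_apply, Pi.smul_apply, smul_eq_mul, finner_add_right', finner_smul_right']
  ring

theorem rank_smul_le' {n : ℕ} (c : ℝ) (X : Matrix (Fin n) (Fin n) ℝ) :
    (c • X).rank ≤ X.rank := by
  have : c • X = (c • (1 : Matrix (Fin n) (Fin n) ℝ)) * X := by simp
  rw [this]
  exact Matrix.rank_mul_le_right _ _

theorem rank_add_le' {n : ℕ} (X Y : Matrix (Fin n) (Fin n) ℝ) :
    (X + Y).rank ≤ X.rank + Y.rank := by
  unfold Matrix.rank
  rw [Matrix.mulVecLin_add]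
  exact (Submodule.finrank_mono (LinearMap.range_add_le _ _)).trans
    (Submodule.finrank_add_le_finrank_add_finrank _ _)

theorem scalar_bound' (δ b d x : ℝ) (hd : 0 ≤ d) (hx : 0 ≤ x)
    (h : ∀ t : ℝ, 2 * t * b ≤ δ * (d ^ 2 + t ^ 2 * x ^ 2)) (hb : d ^ 2 ≤ 2 * b)
    (hδ : 0 ≤ δ * x ^ 2) : d ≤ 2 * δ * x := by
  rcases hx.eq_or_lt with rfl | hx
  · by_contra hc
    have hd' : 0 < d := by simpa using hc
    have hb' : 0 < b := by nlinarith [pow_pos hd' 2]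
    have := h ((δ * d ^ 2 + 1) / (2 * b))
    have e : 2 * ((δ * d ^ 2 + 1) / (2 * b)) * b = δ * d ^ 2 + 1 := by field_simp
    rw [e] at this
    nlinarith
  · have hδ' : 0 ≤ δ := nonneg_of_mul_nonneg_left hδ (by positivity)
    rcases hd.eq_or_lt with rfl | hd
    · positivity
    · have := h (d / x)
      have e : δ * (d ^ 2 + (d / x) ^ 2 * x ^ 2) = 2 * δ * d ^ 2 := by field_simp; ring
      have e2 : 2 * (d / x) * b = (2 * b) * d / x := by ring
      rw [e, e2, div_le_iff₀ hx] at this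
      have h3 : d ^ 2 * d ≤ 2 * δ * d ^ 2 * x := by nlinarith
      have : d ^ 2 * d ≤ d ^ 2 * (2 * δ * x) := by linarith
      exact le_of_mul_le_mul_left this (by positivity)

/-- The one-step hard-thresholding initialization satisfies
`√(Σ_k ‖X_{k,0} − X_k‖_F²) ≤ 2δ₃ᵣ √(Σ_k ‖X_k‖_F²)`. -/
theorem init_bound
    {n m r s : ℕ}
    (A : Fin s → Fin m → Matrix (Fin n) (Fin n) ℝ)
    (δ₃ : ℝ) (hδ₃ : δ₃ < 1)
    (hARIP3 : ARIP (fun k => opA (A k)) (3 * r) δ₃)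
    (X : Fin s → Matrix (Fin n) (Fin n) ℝ) (hX : ∀ k, (X k).rank ≤ r)
    (y : Fin m → ℝ) (hy : y = ∑ k, opA (A k) (X k))
    (X0 : Fin s → Matrix (Fin n) (Fin n) ℝ)
    (hX0 : ∀ k, IsBestRankApprox r (adjA (A k) y) (X0 k)) :
    Real.sqrt (∑ k, fnorm (X0 k - X k) ^ 2) ≤
      2 * δ₃ * Real.sqrt (∑ k, fnorm (X k) ^ 2) := by
  have hexp : ∀ t : ℝ, ∑ k, finner ((X0 k - X k) + t • X k) ((X0 k - X k) + t • X k)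
      = ∑ k, finner (X0 k - X k) (X0 k - X k) + 2 * t * ∑ k, finner (X0 k - X k) (X k)
        + t ^ 2 * ∑ k, finner (X k) (X k) := by
    intro t
    simp only [finner_expand', Finset.sum_add_distrib, Finset.mul_sum]
  set u : Fin m → ℝ := ∑ k, opA (A k) (X0 k - X k) with hu
  have hexpA : ∀ t : ℝ, enorm2 (∑ k, opA (A k) ((X0 k - X k) + t • X k)) ^ 2
      = ∑ p, u p ^ 2 + 2 * t * ∑ p, u p * y p + t ^ 2 * ∑ p, y p ^ 2 := by
    intro t
    have : ∑ k, opA (A k) ((X0 k - X k) + t • X k) = u + t • y := by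
      rw [hu, hy]
      simp only [opA_expand', Finset.sum_add_distrib, Finset.smul_sum]
    rw [this, enorm2_sq', Finset.mul_sum, Finset.mul_sum, ← Finset.sum_add_distrib,
      ← Finset.sum_add_distrib]
    refine Finset.sum_congr rfl fun p _ => ?_
    simp only [Pi.add_apply, Pi.smul_apply, smul_eq_mul]
    ring
  have hrank : ∀ (t : ℝ) (k : Fin s), ((X0 k - X k) + t • X k).rank ≤ 3 * r := by
    intro t k
    have e : (X0 k - X k) + t • X k = X0 k + (t - 1) • X k := by
      rw [sub_smul, one_smul]; abel
    rw [e]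
    have h1 := rank_add_le' (X0 k) ((t - 1) • X k)
    have h2 := rank_smul_le' (t - 1) (X k)
    have h3 := (hX0 k).1
    have h4 := hX k
    omega
  have hadj : ∑ k, finner (X0 k - X k) (adjA (A k) y) = ∑ p, u p * y p := by
    simp only [finner_adjA', hu, Finset.sum_apply, Finset.sum_mul]
    exact Finset.sum_comm
  have hbest : ∀ k, finner (X0 k - X k) (X0 k - X k)
      ≤ 2 * (finner (X0 k - X k) (adjA (A k) y) - finner (X0 k - X k) (X k)) := by
    intro k
    have h1 := (hX0 k).2 (X k) (hX k)
    have h2 := pow_le_pow_left₀ (show 0 ≤ fnorm _ from Real.sqrt_nonneg _) h1 2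
    rw [fnorm_sq', fnorm_sq'] at h2
    have e : X0 k - adjA (A k) y = (X k - adjA (A k) y) + (1 : ℝ) • (X0 k - X k) := by
      rw [one_smul]; abel
    rw [e, finner_expand', finner_comm' _ (X0 k - X k),
      finner_sub_right' (X0 k - X k) (X k)] at h2
    linarith
  have hsum := Finset.sum_le_sum fun k (_ : k ∈ Finset.univ) => hbest k
  rw [← Finset.mul_sum, Finset.sum_sub_distrib, hadj] at hsum
  have hd0 : 0 ≤ ∑ k, finner (X0 k - X k) (X0 k - X k) :=
    Finset.sum_nonneg fun k _ => finner_self_nonneg' _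
  have hx0 : 0 ≤ ∑ k, finner (X k) (X k) :=
    Finset.sum_nonneg fun k _ => finner_self_nonneg' _
  simp only [fnorm_sq']
  refine scalar_bound' δ₃ (∑ p, u p * y p - ∑ k, finner (X0 k - X k) (X k)) _ _
    (Real.sqrt_nonneg _) (Real.sqrt_nonneg _) ?_ ?_ ?_
  · intro t
    rw [Real.sq_sqrt hd0, Real.sq_sqrt hx0]
    have h1 := (hARIP3 _ (hrank t)).2
    have h2 := (hARIP3 _ (hrank (-t))).1
    simp only [fnorm_sq'] at h1 h2
    rw [hexpA, hexp] at h1 h2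
    linarith
  · rw [Real.sq_sqrt hd0]
    exact hsum
  · rw [Real.sq_sqrt hx0]
    have h := hARIP3 X (fun k => by have := hX k; omega)
    simp only [fnorm_sq'] at h
    linarith [h.1, h.2]
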